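/- arXiv:2209.04734 — 5 statements merged into one kernel-verified Lean document; each statement's English description precedes it below -/
import Mathlib

section
/- Let Φ denote the standard normal cumulative distribution function, let ε > 0, and set Q = Φ(1/ε)/Φ(−1/ε). For lists s of elements of {−1, 1} (sequences of past decisions, +1 for option A and −1 for option B), define functions L and T mutually recursively by: L(nil) = 0; T(s) = (ε²/2)·( L(s) + (∑_{c ∈ s} c)·log Q ); and L(s ++ [c]) = L(s) + log Φ(c·(−1 − T(s))/ε) − log Φ(c·(1 − T(s))/ε). Then T(s) = 0 and L(s) = −(∑_{c ∈ s} c)·log Q for every list s. (That is, under the Condorcet competitive reward scheme, which divides the reward of an option by Q for every agent that has already chosen it, the rational private-signal threshold of every agent is zero, so all agents decide independently of the social information.) -/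
/-- The standard normal probability density function. -/
noncomputable def stdNormalPdf (z : ℝ) : ℝ :=
  Real.exp (-z ^ 2 / 2) / Real.sqrt (2 * Real.pi)

/-- The standard normal cumulative distribution function. -/
noncomputable def stdNormalCdf (z : ℝ) : ℝ :=
  ∫ t in Set.Iic z, stdNormalPdf t

theorem integrable_stdNormalPdf : MeasureTheory.Integrable stdNormalPdf := by
  have h := (integrable_exp_neg_mul_sq (b := 1 / 2) (by norm_num)).div_const
    (Real.sqrt (2 * Real.pi))
  refine h.congr (Filter.Eventually.of_forall fun z => ?_)
  simp only [stdNormalPdf]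
  ring_nf

theorem stdNormalPdf_pos (z : ℝ) : 0 < stdNormalPdf z := by
  unfold stdNormalPdf
  positivity

theorem stdNormalCdf_pos (z : ℝ) : 0 < stdNormalCdf z := by
  unfold stdNormalCdf
  rw [MeasureTheory.setIntegral_pos_iff_support_of_nonneg_ae
    (Filter.Eventually.of_forall fun t => (stdNormalPdf_pos t).le)
    integrable_stdNormalPdf.integrableOn]
  have h : Function.support stdNormalPdf = Set.univ :=
    Set.eq_univ_of_forall fun t => (stdNormalPdf_pos t).ne'
  simp [h]

/-- Under the Condorcet competitive reward scheme, the private-signal threshold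
`T s` of every agent is zero and the log-likelihood ratio satisfies
`L s = −(∑ c ∈ s, c)·log Q`, so all agents decide independently of the
social information.  Here `L` and `T` are the mutually recursive functions
defined by `L(nil) = 0`, `T(s) = (ε²/2)·(L(s) + (∑ c ∈ s, c)·log Q)` and
`L(s ++ [c]) = L(s) + log Φ(c·(−1 − T(s))/ε) − log Φ(c·(1 − T(s))/ε)` on lists
`s` of signs in `{−1, 1}`. -/
theorem condorcet_thresholds_eq_zero (ε : ℝ) (hε : 0 < ε)
    (Q : ℝ) (hQ : Q = stdNormalCdf (1 / ε) / stdNormalCdf (-1 / ε))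
    (L T : List ℝ → ℝ)
    (hT : ∀ s : List ℝ, T s = ε ^ 2 / 2 * (L s + s.sum * Real.log Q))
    (hLnil : L [] = 0)
    (hLsnoc : ∀ (s : List ℝ) (c : ℝ), c = 1 ∨ c = -1 →
      L (s ++ [c]) = L s + Real.log (stdNormalCdf (c * (-1 - T s) / ε))
        - Real.log (stdNormalCdf (c * (1 - T s) / ε))) :
    ∀ s : List ℝ, (∀ c ∈ s, c = 1 ∨ c = -1) →
      T s = 0 ∧ L s = -(s.sum * Real.log Q) := by
  have hlogQ : Real.log Q =
      Real.log (stdNormalCdf (1 / ε)) - Real.log (stdNormalCdf (-1 / ε)) := by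
    rw [hQ, Real.log_div (stdNormalCdf_pos _).ne' (stdNormalCdf_pos _).ne']
  have hT_zero : ∀ s : List ℝ, L s = -(s.sum * Real.log Q) → T s = 0 := by
    intro s hs
    rw [hT, hs]
    ring
  suffices hL : ∀ s : List ℝ, (∀ c ∈ s, c = 1 ∨ c = -1) → L s = -(s.sum * Real.log Q) from
    fun s hs => ⟨hT_zero s (hL s hs), hL s hs⟩
  intro s
  induction s using List.reverseRecOn with
  | nil => simp [hLnil]
  | append_singleton s c ih =>
    intro hs
    have hL := ih fun d hd => hs d (List.mem_append_left _ hd)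
    have hc : c = 1 ∨ c = -1 := hs c (by simp)
    rw [hLsnoc s c hc, hT_zero s hL, hL, List.sum_append, List.sum_singleton]
    rcases hc with rfl | rfl
    · simp only [sub_zero, one_mul]
      linear_combination hlogQ
    · simp only [sub_zero, neg_mul, one_mul, neg_neg]
      linear_combination -hlogQ
end

section
/- Let n ≥ 1 be a natural number, q ∈ (1/2, 1), and Q = q/(1−q) (so that Q > 1). If k is a binomial random variable with parameters n and q, then the expected total reward E[ ∑_{j=0}^{k} Q^{−j} ] = ∑_{k'=0}^{n} (n choose k') · q^{k'} · (1−q)^{n−k'} · ( ∑_{j=0}^{k'} Q^{−j} ) equals (Q − 2^n·(1−q)^n)/(Q − 1). -/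
theorem geom_sum_zpow_neg {K : Type*} [Field K] {x : K} (h0 : x ≠ 0) (h1 : x ≠ 1) (k : ℕ) :
    ∑ j ∈ Finset.range (k + 1), x ^ (-(j : ℤ)) = (x - (x ^ k)⁻¹) / (x - 1) := by
  have h : x - 1 ≠ 0 := sub_ne_zero.mpr h1
  induction k with
  | zero => simp [h]
  | succ k ih =>
    rw [Finset.sum_range_succ, ih, zpow_neg, zpow_natCast]
    field_simp
    ring

/-- If `k ~ Bin(n, q)` with `q ∈ (1/2, 1)` and `Q = q/(1−q) > 1`, then the
expected total reward `E[∑_{j=0}^{k} Q^{−j}]` equals `(Q − 2^n (1−q)^n)/(Q − 1)`. -/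
theorem expected_total_reward (n : ℕ) (hn : 1 ≤ n)
    (q : ℝ) (hq : q ∈ Set.Ioo (1 / 2 : ℝ) 1) (Q : ℝ) (hQ : Q = q / (1 - q)) :
    ∑ k ∈ Finset.range (n + 1),
        (n.choose k : ℝ) * q ^ k * (1 - q) ^ (n - k)
          * (∑ j ∈ Finset.range (k + 1), Q ^ (-(j : ℤ)))
      = (Q - 2 ^ n * (1 - q) ^ n) / (Q - 1) := by
  obtain ⟨hq_half, hq_one⟩ := hq
  have hp : 0 < 1 - q := by linarith
  have hq_pos : 0 < q := by linarith
  have hQ_one : 1 < Q := by rw [hQ, one_lt_div hp]; linarith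
  have hQ_pos : 0 < Q := by linarith
  have hQq : q = Q * (1 - q) := by rw [hQ, div_mul_cancel₀ _ hp.ne']
  have hterm : ∀ k ∈ Finset.range (n + 1),
      (n.choose k : ℝ) * q ^ k * (1 - q) ^ (n - k)
          * (∑ j ∈ Finset.range (k + 1), Q ^ (-(j : ℤ)))
        = (Q * (q ^ k * (1 - q) ^ (n - k) * n.choose k)
            - (n.choose k : ℝ) * (1 - q) ^ n) / (Q - 1) := by
    intro k hk
    have hcancel : q ^ k * (Q ^ k)⁻¹ = (1 - q) ^ k := by
      rw [← div_eq_mul_inv, ← div_pow, div_eq_iff hQ_pos.ne' |>.mpr (hQq.trans (mul_comm _ _))]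
    have hpow : (1 - q) ^ n = (1 - q) ^ k * (1 - q) ^ (n - k) := by
      rw [← pow_add, Nat.add_sub_cancel' (Finset.mem_range_succ_iff.mp hk)]
    rw [geom_sum_zpow_neg hQ_pos.ne' hQ_one.ne', hpow, ← hcancel]
    ring
  have hchoose : ∑ k ∈ Finset.range (n + 1), (n.choose k : ℝ) = 2 ^ n := by
    exact_mod_cast Nat.sum_range_choose n
  rw [Finset.sum_congr rfl hterm, ← Finset.sum_div, Finset.sum_sub_distrib, ← Finset.mul_sum,
    ← add_pow, ← Finset.sum_mul, hchoose, add_sub_cancel, one_pow, mul_one]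
end

section
/- Condorcet Jury Theorem (lower bound): let n ≥ 3 be an odd natural number and q ∈ (1/2, 1). Define the majority accuracy M(n, q) = ∑_{k=(n+1)/2}^{n} (n choose k) · q^k · (1−q)^{n−k}. Then M(n, q) > q. -/
/-- For odd `n`, the binomial expansion of `(x + y) ^ n` splits into its upper half and the mirror
image of its upper half. -/
theorem sum_upper_half_add_sum_mirror {R : Type*} [CommSemiring R] {n : ℕ} (hn : Odd n)
    (x y : R) :
    ∑ k ∈ Finset.Icc ((n + 1) / 2) n, (n.choose k : R) * x ^ k * y ^ (n - k) +
      ∑ k ∈ Finset.Icc ((n + 1) / 2) n, (n.choose k : R) * y ^ k * x ^ (n - k) =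
    (x + y) ^ n := by
  obtain ⟨m, rfl⟩ := hn
  have hmirror : ∑ k ∈ Finset.Icc ((2 * m + 1 + 1) / 2) (2 * m + 1),
      ((2 * m + 1).choose k : R) * y ^ k * x ^ (2 * m + 1 - k) =
      ∑ k ∈ Finset.range (m + 1),
        ((2 * m + 1).choose k : R) * x ^ k * y ^ (2 * m + 1 - k) := by
    refine Finset.sum_nbij' (fun k => 2 * m + 1 - k) (fun k => 2 * m + 1 - k) ?_ ?_ ?_ ?_ ?_
    all_goals intro k hk; simp only [Finset.mem_Icc, Finset.mem_range] at hk ⊢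
    · omega
    · omega
    · omega
    · omega
    · rw [Nat.choose_symm hk.2, Nat.sub_sub_self hk.2]
      ring
  have hIcc : Finset.Icc ((2 * m + 1 + 1) / 2) (2 * m + 1) =
      Finset.Ico (m + 1) (2 * m + 1 + 1) := by
    ext k
    simp only [Finset.mem_Icc, Finset.mem_Ico]
    omega
  rw [hmirror, hIcc, add_comm, Finset.sum_range_add_sum_Ico _ (by omega), add_pow]
  exact Finset.sum_congr rfl fun k _ => by ring

/-- Condorcet Jury Theorem (lower bound): for odd `n ≥ 3` and `q ∈ (1/2, 1)`,
the majority accuracy `M(n, q) = ∑_{k=(n+1)/2}^{n} (n choose k) q^k (1−q)^{n−k}`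
strictly exceeds the individual accuracy `q`. -/
theorem condorcet_majority_gt_individual (n : ℕ) (hn : Odd n) (hn3 : 3 ≤ n)
    (q : ℝ) (hq : q ∈ Set.Ioo (1 / 2 : ℝ) 1) :
    q < ∑ k ∈ Finset.Icc ((n + 1) / 2) n,
          (n.choose k : ℝ) * q ^ k * (1 - q) ^ (n - k) := by
  obtain ⟨hq2, hq1⟩ := hq
  have hq0 : 0 < q := by linarith
  have hp0 : 0 < 1 - q := by linarith
  have hsum := sum_upper_half_add_sum_mirror hn q (1 - q)
  rw [add_sub_cancel, one_pow] at hsum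
  have factor (a b c : ℝ) (j d : ℕ) :
      a * (c * b ^ (j + (d + 1)) * a ^ j) = c * (a * b) ^ (j + 1) * b ^ d := by ring
  have hlt : q * ∑ k ∈ Finset.Icc ((n + 1) / 2) n,
        (n.choose k : ℝ) * (1 - q) ^ k * q ^ (n - k) <
      (1 - q) * ∑ k ∈ Finset.Icc ((n + 1) / 2) n,
        (n.choose k : ℝ) * q ^ k * (1 - q) ^ (n - k) := by
    rw [Finset.mul_sum, Finset.mul_sum]
    refine Finset.sum_lt_sum (fun k hk => ?_) ⟨n, Finset.mem_Icc.2 ⟨by omega, le_rfl⟩, ?_⟩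
    · rw [Finset.mem_Icc] at hk
      obtain ⟨d, hd⟩ : ∃ d, k = n - k + (d + 1) := ⟨k - (n - k) - 1, by grind⟩
      generalize n - k = j at hd ⊢
      rw [hd, factor, factor, mul_comm (1 - q) q]
      gcongr
      linarith
    · obtain ⟨d, rfl⟩ : ∃ d, n = d + 1 := ⟨n - 1, by omega⟩
      have hpow : (1 - q) ^ d < q ^ d :=
        pow_lt_pow_left₀ (by linarith) hp0.le (by omega)
      simp only [Nat.choose_self, Nat.sub_self, pow_zero, Nat.cast_one, one_mul, mul_one, pow_succ]
      nlinarith [mul_lt_mul_of_pos_left hpow (mul_pos hq0 hp0)]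
  rw [← eq_sub_iff_add_eq'] at hsum
  rw [hsum] at hlt
  linarith
end

section
/- Condorcet Jury Theorem (monotonicity): let n be an odd natural number and q ∈ (1/2, 1). Define the majority accuracy M(n, q) = ∑_{k=(n+1)/2}^{n} (n choose k) · q^k · (1−q)^{n−k}. Then M(n+2, q) > M(n, q); that is, the probability of a correct majority decision strictly increases when the (odd) group size increases. -/
/-- The probability of exactly `k` successes in `n` trials with success probability `q`. -/
noncomputable def binomialMass (q : ℝ) (n k : ℕ) : ℝ :=
  (n.choose k : ℝ) * q ^ k * (1 - q) ^ (n - k)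

/-- The probability of at least `m` successes in `n` trials with success probability `q`. -/
noncomputable def binomialTail (q : ℝ) (n m : ℕ) : ℝ :=
  ∑ k ∈ Finset.Icc m n, binomialMass q n k

theorem binomialMass_succ_succ (q : ℝ) (n k : ℕ) :
    binomialMass q (n + 1) (k + 1) =
      q * binomialMass q n k + (1 - q) * binomialMass q n (k + 1) := by
  unfold binomialMass
  rcases lt_or_ge k n with h | h
  · obtain ⟨d, rfl⟩ := Nat.exists_eq_add_of_lt h
    rw [Nat.choose_succ_succ, show k + d + 1 + 1 - (k + 1) = d + 1 by omega,
      show k + d + 1 - k = d + 1 by omega, show k + d + 1 - (k + 1) = d by omega]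
    push_cast
    ring
  · rw [Nat.choose_succ_succ, Nat.choose_eq_zero_of_lt (Nat.lt_succ_of_le h),
      Nat.add_sub_add_right]
    push_cast
    ring

theorem binomialTail_eq_add {n m : ℕ} (q : ℝ) (h : m ≤ n) :
    binomialTail q n m = binomialMass q n m + binomialTail q n (m + 1) := by
  rw [binomialTail, binomialTail, Finset.Icc_add_one_left_eq_Ioc,
    Finset.add_sum_Ioc_eq_sum_Icc h]

theorem binomialTail_succ_succ {n m : ℕ} (q : ℝ) (h : m ≤ n) :
    binomialTail q (n + 1) (m + 1) =
      q * binomialTail q n m + (1 - q) * binomialTail q n (m + 1) := by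
  have hshift (f : ℕ → ℝ) :
      ∑ k ∈ Finset.Icc (m + 1) (n + 1), f k = ∑ k ∈ Finset.Icc m n, f (k + 1) := by
    rw [← Finset.map_add_right_Icc, Finset.sum_map]
    rfl
  have htop : ∑ k ∈ Finset.Icc m n, binomialMass q n (k + 1) = binomialTail q n (m + 1) := by
    rw [← hshift, Finset.sum_Icc_succ_top (by omega)]
    simp [binomialTail, binomialMass]
  rw [binomialTail, hshift, ← htop, binomialTail]
  simp only [binomialMass_succ_succ, Finset.sum_add_distrib, Finset.mul_sum]

/-- The gain in majority accuracy when two agents join a group of size `2 * m + 1`. -/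
theorem binomialTail_majority_sub (q : ℝ) (m : ℕ) :
    binomialTail q (2 * m + 3) (m + 2) - binomialTail q (2 * m + 1) (m + 1) =
      ((2 * m + 1).choose m : ℝ) * (q * (1 - q)) ^ (m + 1) * (2 * q - 1) := by
  have h₁ := binomialTail_succ_succ q (show m + 1 ≤ 2 * m + 2 by omega)
  have h₂ := binomialTail_eq_add q (show m + 1 ≤ 2 * m + 2 by omega)
  have h₃ := binomialTail_succ_succ q (show m ≤ 2 * m + 1 by omega)
  have h₄ := binomialTail_eq_add q (show m ≤ 2 * m + 1 by omega)
  have h₅ := binomialMass_succ_succ q (2 * m + 1) m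
  have h₆ : binomialMass q (2 * m + 1) m =
      ((2 * m + 1).choose m : ℝ) * q ^ m * (1 - q) ^ (m + 1) := by
    rw [binomialMass, show 2 * m + 1 - m = m + 1 by omega]
  have h₇ : binomialMass q (2 * m + 1) (m + 1) =
      ((2 * m + 1).choose m : ℝ) * q ^ (m + 1) * (1 - q) ^ m := by
    rw [binomialMass, show 2 * m + 1 - (m + 1) = m by omega, Nat.choose_symm_half]
  have hgain : binomialTail q (2 * m + 3) (m + 2) - binomialTail q (2 * m + 1) (m + 1) =
      q ^ 2 * binomialMass q (2 * m + 1) m -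
        (1 - q) ^ 2 * binomialMass q (2 * m + 1) (m + 1) := by
    linear_combination h₁ - (1 - q) * h₂ + h₃ + q * h₄ - (1 - q) * h₅
  rw [hgain, h₆, h₇, mul_pow]
  ring


/-- Condorcet Jury Theorem (monotonicity): for odd `n` and `q ∈ (1/2, 1)`,
the majority accuracy `M(n, q) = ∑_{k=(n+1)/2}^{n} (n choose k) q^k (1−q)^{n−k}`
strictly increases when the group size increases from `n` to `n + 2`. -/
theorem condorcet_majority_monotone (n : ℕ) (hn : Odd n)
    (q : ℝ) (hq : q ∈ Set.Ioo (1 / 2 : ℝ) 1) :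
    ∑ k ∈ Finset.Icc ((n + 1) / 2) n,
        (n.choose k : ℝ) * q ^ k * (1 - q) ^ (n - k)
      < ∑ k ∈ Finset.Icc ((n + 2 + 1) / 2) (n + 2),
          ((n + 2).choose k : ℝ) * q ^ k * (1 - q) ^ (n + 2 - k) := by
  obtain ⟨m, rfl⟩ := hn
  obtain ⟨hq₁, hq₂⟩ := hq
  rw [show (2 * m + 1 + 1) / 2 = m + 1 by omega, show (2 * m + 1 + 2 + 1) / 2 = m + 2 by omega]
  have hchoose : (0 : ℝ) < (2 * m + 1).choose m :=
    Nat.cast_pos.mpr (Nat.choose_pos (by omega))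
  have hprod : 0 < q * (1 - q) := mul_pos (by linarith) (by linarith)
  have hodds : 0 < 2 * q - 1 := by linarith
  have hgain : 0 < ((2 * m + 1).choose m : ℝ) * (q * (1 - q)) ^ (m + 1) * (2 * q - 1) := by
    positivity
  rw [← binomialTail_majority_sub] at hgain
  exact sub_pos.mp hgain
end

section
/- Condorcet Jury Theorem (asymptotic): let q ∈ (1/2, 1) and define, for odd n, the majority accuracy M(n, q) = ∑_{k=(n+1)/2}^{n} (n choose k) · q^k · (1−q)^{n−k}. Then M(n, q) tends to 1 as n tends to infinity along odd values; that is, for every δ > 0 there exists N such that for all odd n ≥ N, M(n, q) > 1 − δ. -/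
/-- Lower tail bound for a binomial distribution with an odd number of trials. -/
theorem sum_range_choose_mul_pow_le (q : ℝ) (hq : 1 / 2 ≤ q) (hq1 : q ≤ 1) (m : ℕ) :
    ∑ k ∈ Finset.range (m + 1),
        ((2 * m + 1).choose k : ℝ) * q ^ k * (1 - q) ^ (2 * m + 1 - k) ≤
      (4 * q * (1 - q)) ^ m := by
  have hp : 0 ≤ 1 - q := by linarith
  calc
    _ ≤ ∑ k ∈ Finset.range (m + 1), ((2 * m + 1).choose k : ℝ) * (q * (1 - q)) ^ m := by
      refine Finset.sum_le_sum fun k hk => ?_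
      obtain ⟨d, rfl⟩ := Nat.exists_eq_add_of_le (Finset.mem_range_succ_iff.mp hk)
      rw [show 2 * (k + d) + 1 - k = (k + d) + (d + 1) by omega, mul_assoc]
      gcongr
      calc
        q ^ k * (1 - q) ^ (k + d + (d + 1)) =
            q ^ k * (1 - q) ^ (k + d) * ((1 - q) ^ d * (1 - q)) := by ring
        _ ≤ q ^ k * (1 - q) ^ (k + d) * (q ^ d * 1) := by
          gcongr <;> linarith
        _ = (q * (1 - q)) ^ (k + d) := by rw [mul_pow]; ring
    _ = (4 * q * (1 - q)) ^ m := by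
      rw [← Finset.sum_mul, ← Nat.cast_sum, Nat.sum_range_choose_halfway, mul_assoc 4,
        mul_pow 4]
      norm_num

/-- Condorcet Jury Theorem (asymptotic): for `q ∈ (1/2, 1)`, the majority
accuracy `M(n, q) = ∑_{k=(n+1)/2}^{n} (n choose k) q^k (1−q)^{n−k}` tends to `1`
along odd group sizes `n`: for every `δ > 0` there is `N` such that
`M(n, q) > 1 − δ` for all odd `n ≥ N`. -/
theorem condorcet_majority_tendsto_one (q : ℝ) (hq : q ∈ Set.Ioo (1 / 2 : ℝ) 1) :
    ∀ δ > (0 : ℝ), ∃ N : ℕ, ∀ n : ℕ, N ≤ n → Odd n →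
      1 - δ < ∑ k ∈ Finset.Icc ((n + 1) / 2) n,
          (n.choose k : ℝ) * q ^ k * (1 - q) ^ (n - k) := by
  intro δ hδ
  obtain ⟨hq0, hq1⟩ := hq
  have hr0 : 0 ≤ 4 * q * (1 - q) := mul_nonneg (by linarith) (by linarith)
  have hr1 : 4 * q * (1 - q) < 1 := by nlinarith
  obtain ⟨N, hN⟩ := exists_pow_lt_of_lt_one hδ hr1
  refine ⟨2 * N, ?_⟩
  rintro _ hn ⟨m, rfl⟩
  have hsum : ∑ k ∈ Finset.range (2 * m + 1 + 1),
      ((2 * m + 1).choose k : ℝ) * q ^ k * (1 - q) ^ (2 * m + 1 - k) = 1 := by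
    have h := add_pow q (1 - q) (2 * m + 1)
    rw [add_sub_cancel, one_pow] at h
    exact (Finset.sum_congr rfl fun k _ => by ring).trans h.symm
  rw [← Finset.sum_range_add_sum_Ico _ (show m + 1 ≤ 2 * m + 1 + 1 by omega)] at hsum
  have htail := sum_range_choose_mul_pow_le q hq0.le hq1.le m
  have hpow := pow_le_pow_of_le_one hr0 hr1.le (show N ≤ m by omega)
  rw [show (2 * m + 1 + 1) / 2 = m + 1 by omega,
    show Finset.Icc (m + 1) (2 * m + 1) = Finset.Ico (m + 1) (2 * m + 1 + 1) by
      ext; simp]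
  linarith
end
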